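/- Let p1,...,p6 be natural numbers. Any induced r-cycle in Ḡ(p) with r ≥ 4 contains at most one vertex of each of the four letters a, b, c, d; consequently, Ḡ(p) contains no induced r-cycle for any r ≥ 5. -/

import Mathlib

/-- The four letters labeling vertices. -/
inductive Letter : Type
  | a | b | c | d
deriving DecidableEq

/-- Whether a labeled vertex is in range for the exponent vector `(p1,…,p6)`. -/
def inRange (p1 p2 p3 p4 p5 p6 : ℕ) : Letter × ℕ → Prop
  | (Letter.a, i) => 1 ≤ i ∧ i ≤ max p1 (max p2 p3)
  | (Letter.b, j) => 1 ≤ j ∧ j ≤ max p1 (max p4 p5)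
  | (Letter.c, l) => 1 ≤ l ∧ l ≤ max p2 (max p4 p6)
  | (Letter.d, m) => 1 ≤ m ∧ m ≤ max p3 (max p5 p6)

/-- The vertex set of the graph `G(p)`. -/
def Vertex (p1 p2 p3 p4 p5 p6 : ℕ) : Type :=
  {v : Letter × ℕ // inRange p1 p2 p3 p4 p5 p6 v}

/-- Directed adjacency (one orientation of each cross-letter edge rule). -/
def dirAdj (p1 p2 p3 p4 p5 p6 : ℕ) : Letter × ℕ → Letter × ℕ → Prop
  | (Letter.a, i), (Letter.b, j) => i + j ≤ p1 + 1
  | (Letter.a, i), (Letter.c, l) => i + l ≤ p2 + 1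
  | (Letter.a, i), (Letter.d, m) => i + m ≤ p3 + 1
  | (Letter.b, j), (Letter.c, l) => j + l ≤ p4 + 1
  | (Letter.b, j), (Letter.d, m) => j + m ≤ p5 + 1
  | (Letter.c, l), (Letter.d, m) => l + m ≤ p6 + 1
  | _, _ => False

/-- The graph `G(p)` whose edge ideal is the Alexander dual of the polarization. -/
def tetraGraph (p1 p2 p3 p4 p5 p6 : ℕ) : SimpleGraph (Vertex p1 p2 p3 p4 p5 p6) where
  Adj u v := dirAdj p1 p2 p3 p4 p5 p6 u.val v.val ∨ dirAdj p1 p2 p3 p4 p5 p6 v.val u.val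
  symm := ⟨fun u v h => h.symm⟩
  loopless := by
    constructor
    rintro ⟨⟨L, i⟩, _⟩ h
    cases L <;> simp [dirAdj] at h

/-- An induced `r`-cycle in a graph: `r` distinct vertices, adjacent exactly when
cyclically consecutive. -/
def IsInducedCycle {V : Type*} (H : SimpleGraph V) (r : ℕ) (v : Fin r → V) : Prop :=
  Function.Injective v ∧
    ∀ s t : Fin r, H.Adj (v s) (v t) ↔ ((s.val + 1) % r = t.val ∨ (t.val + 1) % r = s.val)

instance : Fintype Letter where
  elems := {Letter.a, Letter.b, Letter.c, Letter.d}
  complete x := by cases x <;> simp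

theorem Letter.card : Fintype.card Letter = 4 := rfl

/-- Distinct vertices with the same letter are adjacent in the complement graph. -/
theorem tetraGraph_compl_adj_of_letter_eq {p1 p2 p3 p4 p5 p6 : ℕ}
    {u v : Vertex p1 p2 p3 p4 p5 p6} (huv : u ≠ v) (hl : u.val.1 = v.val.1) :
    (tetraGraph p1 p2 p3 p4 p5 p6)ᶜ.Adj u v := by
  rw [SimpleGraph.compl_adj]
  refine ⟨huv, ?_⟩
  obtain ⟨⟨x, i⟩, _⟩ := u
  obtain ⟨⟨y, j⟩, _⟩ := v
  dsimp only at hl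
  subst hl
  cases x <;> simp [tetraGraph, dirAdj]

/-- For a fixed letter, neighborhoods in the complement graph grow with the index. -/
theorem tetraGraph_compl_adj_mono {p1 p2 p3 p4 p5 p6 : ℕ}
    {u v w : Vertex p1 p2 p3 p4 p5 p6} (hl : u.val.1 = v.val.1) (hle : u.val.2 ≤ v.val.2)
    (hvw : v ≠ w) (h : (tetraGraph p1 p2 p3 p4 p5 p6)ᶜ.Adj u w) :
    (tetraGraph p1 p2 p3 p4 p5 p6)ᶜ.Adj v w := by
  rw [SimpleGraph.compl_adj] at h ⊢
  refine ⟨hvw, fun hadj => h.2 ?_⟩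
  obtain ⟨⟨x, i⟩, _⟩ := u
  obtain ⟨⟨y, j⟩, _⟩ := v
  obtain ⟨⟨z, k⟩, _⟩ := w
  dsimp only at hl hle
  subst hl
  cases x <;> cases z <;> simp only [tetraGraph, dirAdj, or_false, false_or] at hadj ⊢ <;> omega

theorem Nat.succ_mod_eq_iff {r a b : ℕ} (ha : a < r) :
    (a + 1) % r = b ↔ (a + 1 < r ∧ b = a + 1) ∨ (a + 1 = r ∧ b = 0) := by
  rcases Nat.lt_or_ge (a + 1) r with h | h
  · rw [Nat.mod_eq_of_lt h]
    omega
  · obtain rfl : a + 1 = r := by omega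
    rw [Nat.mod_self]
    omega

/-- In a cycle of length at least four, every neighbor `t` of `s` misses some other
neighbor of `s`. -/
theorem exists_cyclic_neighbor_not_neighbor {r : ℕ} (hr : 4 ≤ r) {s t : Fin r}
    (h : (s.val + 1) % r = t.val ∨ (t.val + 1) % r = s.val) :
    ∃ w : Fin r, t ≠ w ∧ ((s.val + 1) % r = w.val ∨ (w.val + 1) % r = s.val) ∧
      ¬ ((t.val + 1) % r = w.val ∨ (w.val + 1) % r = t.val) := by
  obtain ⟨s, hs⟩ := s
  obtain ⟨t, ht⟩ := t
  simp only [Nat.succ_mod_eq_iff hs, Nat.succ_mod_eq_iff ht] at h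
  have key : ∀ w (hw : w < r), t ≠ w →
      ((s + 1 < r ∧ w = s + 1) ∨ (s + 1 = r ∧ w = 0) ∨
        (w + 1 < r ∧ s = w + 1) ∨ (w + 1 = r ∧ s = 0)) →
      ∃ w : Fin r, (⟨t, ht⟩ : Fin r) ≠ w ∧
        ((s + 1) % r = w.val ∨ (w.val + 1) % r = s) ∧
        ¬ ((t + 1) % r = w.val ∨ (w.val + 1) % r = t) := by
    intro w hw htw hsw
    refine ⟨⟨w, hw⟩, by simpa using htw, ?_, ?_⟩ <;>
      simp only [Nat.succ_mod_eq_iff hs, Nat.succ_mod_eq_iff ht, Nat.succ_mod_eq_iff hw] <;>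
      omega
  rcases h with h | h
  · rcases Nat.eq_zero_or_pos s with h0 | h0
    · exact key (r - 1) (by omega) (by omega) (by omega)
    · exact key (s - 1) (by omega) (by omega) (by omega)
  · rcases Nat.lt_or_ge (s + 1) r with h1 | h1
    · exact key (s + 1) h1 (by omega) (by omega)
    · exact key 0 (by omega) (by omega) (by omega)

theorem IsInducedCycle.eq_of_letter_eq {p1 p2 p3 p4 p5 p6 r : ℕ} (hr : 4 ≤ r)
    {v : Fin r → Vertex p1 p2 p3 p4 p5 p6}
    (hv : IsInducedCycle (tetraGraph p1 p2 p3 p4 p5 p6)ᶜ r v) {s t : Fin r}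
    (hl : (v s).val.1 = (v t).val.1) : s = t := by
  wlog hle : (v s).val.2 ≤ (v t).val.2 generalizing s t
  · exact (this hl.symm (Nat.le_of_not_le hle)).symm
  by_contra hst
  have hadj := tetraGraph_compl_adj_of_letter_eq (hv.1.ne hst) hl
  obtain ⟨w, htw, hsw, hnot⟩ := exists_cyclic_neighbor_not_neighbor hr ((hv.2 s t).1 hadj)
  exact hnot ((hv.2 t w).1
    (tetraGraph_compl_adj_mono hl hle (hv.1.ne htw) ((hv.2 s w).2 hsw)))

/-- From the proof of Lemma 3.3: any induced `r`-cycle (`r ≥ 4`) in `Ḡ(p)` has at most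
one vertex of each letter; consequently `Ḡ(p)` has no induced `r`-cycle for `r ≥ 5`. -/
theorem induced_cycle_letters_distinct (p1 p2 p3 p4 p5 p6 : ℕ) :
    (∀ r : ℕ, 4 ≤ r → ∀ v : Fin r → Vertex p1 p2 p3 p4 p5 p6,
      IsInducedCycle (tetraGraph p1 p2 p3 p4 p5 p6)ᶜ r v →
        ∀ s t : Fin r, (v s).val.1 = (v t).val.1 → s = t) ∧
    (∀ r : ℕ, 5 ≤ r → ¬ ∃ v : Fin r → Vertex p1 p2 p3 p4 p5 p6,
      IsInducedCycle (tetraGraph p1 p2 p3 p4 p5 p6)ᶜ r v) := by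
  refine ⟨fun r hr v hv s t hl => hv.eq_of_letter_eq hr hl, ?_⟩
  rintro r hr ⟨v, hv⟩
  have hinj : Function.Injective fun s => (v s).val.1 :=
    fun s t hl => hv.eq_of_letter_eq (by omega) hl
  have hcard := Fintype.card_le_of_injective _ hinj
  rw [Fintype.card_fin, Letter.card] at hcard
  omega
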